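/- arXiv:1003.1535 — 2 statements merged into one kernel-verified Lean document; each statement's English description precedes it below -/
import Mathlib

section
/- Let k ≥ 1 be an integer and let K ∈ 𝒦_{2k+1} be the Legendre-polynomial kernel, with K_i the i-th derivative of its polynomial part. Then K_i(-1) = K_i(1) = 0 for i = 1, 2, 3, and K₁(0) = 0. -/
open MeasureTheory ProbabilityTheory Filter Set Topology

noncomputable section

/-- Normalising constant `a_k` of the kink-detection kernel. -/
def kinkA (k : ℕ) : ℝ :=
  (Nat.factorial (4*k+5) : ℝ) /
    (2^(4*k+5) * (Nat.factorial (2*k) : ℝ) * (Nat.factorial (2*k+2) : ℝ))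

/-- Polynomial coefficients `b_{j,k}` of the kink-detection kernel. -/
def kinkB (j k : ℕ) : ℝ :=
  ((-1 : ℝ)^(k+j+1) * (Nat.factorial (2*j) : ℝ)) /
    ((Nat.factorial j : ℝ) * (Nat.factorial (2*k+2-j) : ℝ) *
      (Nat.factorial (2*j+2-2*k) : ℝ))

/-- The polynomial part of the kernel `K ∈ 𝒦_{2k+1}`. -/
def kinkPoly (k : ℕ) : ℝ → ℝ := fun x =>
  kinkA k * ∑ j ∈ Finset.Icc (k-1) (2*k+2), kinkB j k * x ^ (2*j+2-2*k)

/-- `Kd k i` is the `i`-th derivative of the polynomial part of the kernel. -/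
def Kd (k i : ℕ) : ℝ → ℝ := iteratedDeriv i (kinkPoly k)

/-- `Kde k i` is the `i`-th derivative of the polynomial part of the kernel,
extended by `0` outside `[-1,1]`. -/
def Kde (k i : ℕ) : ℝ → ℝ := fun x => if x ∈ Set.Icc (-1:ℝ) 1 then Kd k i x else 0

/-- The smoothed third derivative `κ_h(t, μ) = h⁻⁴ ∫₀¹ K₃((x-t)/h) μ(x) dx`. -/
def kappah (k : ℕ) (h t : ℝ) (μ : ℝ → ℝ) : ℝ :=
  (h^4)⁻¹ * ∫ x in (0:ℝ)..1, Kde k 3 ((x - t)/h) * μ x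

/-- The class `ℱ_s(λ)`: a kink of size `a_μ ≠ 0` in the first derivative at `λ`,
with `s`-smooth one-sided extensions whose derivatives of orders `2,…,s-1` match at `λ`. -/
def MemF (s : ℕ) (lam : ℝ) (μ : ℝ → ℝ) : Prop :=
  ∃ gm gp : ℝ → ℝ, ContDiff ℝ (s : ℕ∞) gm ∧ ContDiff ℝ (s : ℕ∞) gp ∧
    (∀ x ≤ lam, μ x = gm x) ∧ (∀ x, lam ≤ x → μ x = gp x) ∧
    deriv gp lam - deriv gm lam ≠ 0 ∧
    ∀ i, 2 ≤ i → i ≤ s - 1 → iteratedDeriv i gp lam = iteratedDeriv i gm lam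

/-- The no-kink class `𝒢_s`. -/
def MemG (s : ℕ) (μ : ℝ → ℝ) : Prop := ContDiff ℝ (s : ℕ∞) μ

/-- A slowly varying function. -/
def SlowlyVarying (L : ℝ → ℝ) : Prop :=
  (∀ x, 0 < x → 0 < L x) ∧
    ∀ c : ℝ, 0 < c → Tendsto (fun x : ℝ => L (c * x) / L x) atTop (𝓝 1)

/-- Coefficients of the causal LRD linear process. -/
def lrdCoef (α : ℝ) (L : ℝ → ℝ) : ℕ → ℝ := fun i =>
  if i = 0 then 1 else (i : ℝ) ^ (-((1 + α) / 2)) * L i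

/-- The filtration `ℱ_i = σ(…, η_{i-1}, η_i)` generated by the innovations. -/
def lrdFilt {Ω : Type*} [MeasurableSpace Ω] (η : ℤ → Ω → ℝ) (i : ℤ) : MeasurableSpace Ω :=
  ⨆ j : ℤ, ⨆ _ : j ≤ i, MeasurableSpace.comap (η j) (inferInstance : MeasurableSpace ℝ)


open Polynomial in
/-- The even polynomial `(1 - X²) ^ n` expanded by the binomial theorem. -/
lemma one_sub_X_sq_pow_eq_sum (n : ℕ) :
    ((1 - X ^ 2) ^ n : ℝ[X]) =
      ∑ j ∈ Finset.range (n + 1), C ((-1 : ℝ) ^ j * (n.choose j : ℝ)) * X ^ (2 * j) := by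
  rw [sub_eq_neg_add, add_pow]
  refine Finset.sum_congr rfl fun j _ => ?_
  simp only [one_pow, mul_one, map_mul, map_pow, map_neg, map_one, map_natCast]
  rw [neg_pow, ← pow_mul]
  ring

open Polynomial in
lemma eval_iterate_derivative_one_sub_X_sq_pow (n m : ℕ) (x : ℝ) :
    (derivative^[m] ((1 - X ^ 2) ^ n : ℝ[X])).eval x =
      ∑ j ∈ Finset.range (n + 1),
        (-1 : ℝ) ^ j * (n.choose j : ℝ) * (((2 * j).descFactorial m : ℝ) * x ^ (2 * j - m)) := by
  rw [one_sub_X_sq_pow_eq_sum, iterate_derivative_sum, eval_finsetSum]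
  refine Finset.sum_congr rfl fun j _ => ?_
  rw [iterate_derivative_C_mul, iterate_derivative_X_pow_eq_C_mul]
  simp

lemma kinkB_eq {j k : ℕ} (hk : 1 ≤ k) (hkj : k ≤ j + 1) (hj : j ≤ 2 * k + 2) :
    kinkB j k = (-1 : ℝ) ^ (k + 1) / (Nat.factorial (2 * k + 2) : ℝ) *
      ((-1 : ℝ) ^ j * ((2 * k + 2).choose j : ℝ) * ((2 * j).descFactorial (2 * k - 2) : ℝ)) := by
  have hd := Nat.factorial_mul_descFactorial (n := 2 * j) (k := 2 * k - 2) (by omega)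
  rw [show 2 * j - (2 * k - 2) = 2 * j + 2 - 2 * k by omega] at hd
  rw [kinkB, Nat.cast_choose ℝ hj, ← hd]
  have h (n : ℕ) : (Nat.factorial n : ℝ) ≠ 0 := Nat.cast_ne_zero.2 (Nat.factorial_ne_zero n)
  push_cast
  have h1 := h (2 * j + 2 - 2 * k)
  have h2 := h (2 * k + 2 - j)
  have h3 := h (2 * k + 2)
  have h4 := h j
  field_simp
  ring

open Polynomial in
/-- Rodrigues-type formula: the kernel is a multiple of a derivative of `(1 - X²) ^ (2k+2)`. -/
lemma kinkPoly_eq_eval {k : ℕ} (hk : 1 ≤ k) :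
    kinkPoly k = fun x => (C (kinkA k * ((-1) ^ (k + 1) / (Nat.factorial (2 * k + 2) : ℝ))) *
      derivative^[2 * k - 2] ((1 - X ^ 2) ^ (2 * k + 2))).eval x := by
  funext x
  rw [eval_C_mul, eval_iterate_derivative_one_sub_X_sq_pow, kinkPoly, mul_assoc]
  congr 1
  rw [Finset.mul_sum]
  have hsub : Finset.Icc (k - 1) (2 * k + 2) ⊆ Finset.range (2 * k + 2 + 1) := fun j hj => by
    simp only [Finset.mem_Icc, Finset.mem_range] at hj ⊢
    omega
  refine (Finset.sum_congr rfl fun j hj => ?_).trans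
    (Finset.sum_subset hsub fun j hj hj' => ?_)
  · rw [Finset.mem_Icc] at hj
    rw [kinkB_eq hk (by omega) hj.2, show 2 * j + 2 - 2 * k = 2 * j - (2 * k - 2) by omega]
    ring
  · simp only [Finset.mem_Icc, Finset.mem_range] at hj hj'
    rw [Nat.descFactorial_eq_zero_iff_lt.2 (by omega)]
    simp

open Polynomial in
lemma iteratedDeriv_polynomial_eval (p : ℝ[X]) (i : ℕ) :
    iteratedDeriv i (fun x => p.eval x) = fun x => (derivative^[i] p).eval x := by
  induction i with
  | zero => simp
  | succ i ih =>
    rw [iteratedDeriv_succ, ih, Function.iterate_succ_apply']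
    funext x
    exact Polynomial.deriv _

open Polynomial in
lemma Kd_eq {k : ℕ} (hk : 1 ≤ k) (i : ℕ) (x : ℝ) :
    Kd k i x = kinkA k * ((-1) ^ (k + 1) / (Nat.factorial (2 * k + 2) : ℝ)) *
      (derivative^[i + (2 * k - 2)] ((1 - X ^ 2) ^ (2 * k + 2) : ℝ[X])).eval x := by
  rw [Kd, kinkPoly_eq_eval hk, iteratedDeriv_polynomial_eval]
  simp only [iterate_derivative_C_mul, eval_C_mul, Function.iterate_add_apply]

open Polynomial in
lemma eval_iterate_derivative_one_sub_X_sq_pow_eq_zero {n m : ℕ} (hm : m < n) {x : ℝ}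
    (hx : x ^ 2 = 1) : (derivative^[m] ((1 - X ^ 2) ^ n : ℝ[X])).eval x = 0 := by
  refine eval_eq_zero_of_dvd_of_eval_eq_zero
    (pow_sub_dvd_iterate_derivative_pow (1 - X ^ 2 : ℝ[X]) n m) ?_
  simp [hx, Nat.sub_ne_zero_of_lt hm]

open Polynomial in
lemma eval_zero_iterate_derivative_one_sub_X_sq_pow_eq_zero {n m : ℕ} (hm : Odd m) :
    (derivative^[m] ((1 - X ^ 2) ^ n : ℝ[X])).eval 0 = 0 := by
  rw [eval_iterate_derivative_one_sub_X_sq_pow]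
  refine Finset.sum_eq_zero fun j _ => ?_
  obtain ⟨r, rfl⟩ := hm
  rcases lt_or_gt_of_ne (show 2 * j ≠ 2 * r + 1 by omega) with h | h
  · rw [Nat.descFactorial_eq_zero_iff_lt.2 h]
    simp
  · simp [Nat.sub_ne_zero_of_lt h]

/-- boundary conditions of the kernel derivatives. -/
theorem kernel_boundary_conditions (k : ℕ) (hk : 1 ≤ k) :
    (∀ i, i = 1 ∨ i = 2 ∨ i = 3 → Kd k i (-1) = 0 ∧ Kd k i 1 = 0) ∧ Kd k 1 0 = 0 := by
  refine ⟨fun i hi => ?_, ?_⟩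
  · have hlt : i + (2 * k - 2) < 2 * k + 2 := by omega
    constructor <;> rw [Kd_eq hk, eval_iterate_derivative_one_sub_X_sq_pow_eq_zero hlt (by norm_num),
      mul_zero]
  · have hodd : Odd (1 + (2 * k - 2)) := ⟨k - 1, by omega⟩
    rw [Kd_eq hk, eval_zero_iterate_derivative_one_sub_X_sq_pow_eq_zero hodd, mul_zero]

end
end

section
/- Let s = 2k+1 with k ≥ 1, K ∈ 𝒦_s, and let μ ∈ 𝒢_s([0,1]), i.e. μ : [0,1] → ℝ has s-1 finite derivatives everywhere and μ' admits, at every point, Taylor expansions of order s-2 with O(x^{s-1}) remainder, with no jump in μ' anywhere. Then there exists C > 0 such that for all h ∈ (0,1) and all t ∈ (h, 1-h), |κ_h(t, μ)| ≤ C h^{s-3}. -/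
open MeasureTheory ProbabilityTheory Filter Set Topology

noncomputable section

open Polynomial in
/-- Polynomial part of the kernel: a multiple of the `(2k-2)`-nd derivative of
`(1 - X²)^(2k+2)`. -/
theorem kinkPoly_eq_eval_iterate_derivative (m : ℕ) :
    ∃ c : ℝ, kinkPoly (m + 1) =
      fun x => (C c * derivative^[2 * m] ((1 - X ^ 2 : ℝ[X]) ^ (2 * m + 4))).eval x := by
  refine ⟨kinkA (m + 1) * ((-1) ^ m / (2 * m + 4).factorial), ?_⟩
  have expand : (1 - X ^ 2 : ℝ[X]) ^ (2 * m + 4) =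
      ∑ j ∈ Finset.range (2 * m + 4 + 1),
        C ((-1) ^ j * ((2 * m + 4).choose j : ℝ)) * X ^ (2 * j) := by
    rw [sub_eq_neg_add, add_pow]
    refine Finset.sum_congr rfl fun j _ => ?_
    rw [neg_pow, pow_mul]
    simp
    ring
  funext x
  rw [expand, iterate_derivative_sum]
  simp only [kinkPoly, eval_mul, eval_C, eval_finsetSum, iterate_derivative_C_mul,
    iterate_derivative_X_pow_eq_smul, mul_assoc, Finset.mul_sum]
  have hsub : Finset.Icc (m + 1 - 1) (2 * (m + 1) + 2) ⊆ Finset.range (2 * m + 4 + 1) := by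
    intro j hj
    simp only [Finset.mem_Icc, Finset.mem_range] at hj ⊢
    omega
  rw [← Finset.sum_subset hsub]
  · refine Finset.sum_congr rfl fun j hj => ?_
    simp only [Finset.mem_Icc] at hj
    obtain ⟨hj₁, hj₂⟩ := hj
    have e₁ : 2 * j + 2 - 2 * (m + 1) = 2 * j - 2 * m := by omega
    have e₂ : 2 * (m + 1) + 2 - j = 2 * m + 4 - j := by omega
    have hchoose := Nat.choose_mul_factorial_mul_factorial (show j ≤ 2 * m + 4 by omega)
    have hdesc := Nat.factorial_mul_descFactorial (show 2 * m ≤ 2 * j by omega)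
    have hchoose' : ((2 * m + 4).choose j : ℝ) * j.factorial * (2 * m + 4 - j).factorial =
        (2 * m + 4).factorial := by exact_mod_cast hchoose
    have hdesc' : ((2 * j - 2 * m).factorial : ℝ) * (2 * j).descFactorial (2 * m) =
        (2 * j).factorial := by exact_mod_cast hdesc
    have hsign : (-1 : ℝ) ^ (m + 1 + j + 1) = (-1) ^ m * (-1) ^ j := by ring
    have h₁ : ((2 * m + 4).choose j : ℝ) ≠ 0 := by
      exact_mod_cast (Nat.choose_pos (by omega)).ne'
    simp only [kinkB, e₁, e₂, hsign, eval_smul, eval_pow, eval_X, smul_eq_mul,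
      ← hchoose', ← hdesc']
    have h₂ : (j.factorial : ℝ) ≠ 0 := by positivity
    have h₃ : ((2 * m + 4 - j).factorial : ℝ) ≠ 0 := by positivity
    have h₄ : ((2 * j - 2 * m).factorial : ℝ) ≠ 0 := by positivity
    field_simp
  · intro j hj hj'
    simp only [Finset.mem_Icc, Finset.mem_range] at hj hj'
    rw [Nat.descFactorial_of_lt (by omega)]
    simp

open Polynomial in
theorem Polynomial.iteratedDeriv_eval (p : ℝ[X]) (n : ℕ) :
    iteratedDeriv n (fun x => p.eval x) = fun x => (derivative^[n] p).eval x := by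
  induction n generalizing p with
  | zero => simp
  | succ n ih =>
    have : deriv (fun x => p.eval x) = fun x => (derivative p).eval x := by
      funext x
      exact p.deriv
    rw [iteratedDeriv_succ', this, ih, Function.iterate_succ_apply]

open Polynomial in
theorem eval_iterate_derivative_one_sub_sq_pow {N n : ℕ} (hn : n < N) {a : ℝ}
    (ha : a ^ 2 = 1) : (derivative^[n] ((1 - X ^ 2 : ℝ[X]) ^ N)).eval a = 0 := by
  obtain ⟨q, hq⟩ := pow_sub_dvd_iterate_derivative_of_pow_dvd n
    (dvd_refl ((1 - X ^ 2 : ℝ[X]) ^ N))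
  rw [hq]
  simp [ha, show N - n ≠ 0 by omega]

open Polynomial in
/-- Repeated integration by parts against `(1 - X²)^N`, with vanishing boundary terms. -/
theorem integral_iterate_derivative_one_sub_sq_pow {N n : ℕ} (hn : n ≤ N) {f : ℝ → ℝ}
    (hf : ContDiff ℝ n f) :
    ∫ u in (-1 : ℝ)..1, (derivative^[n] ((1 - X ^ 2 : ℝ[X]) ^ N)).eval u * f u =
      (-1) ^ n * ∫ u in (-1 : ℝ)..1, (1 - u ^ 2) ^ N * iteratedDeriv n f u := by
  induction n generalizing f with
  | zero => simp
  | succ n ih =>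
    have hf' : ContDiff ℝ n (deriv f) := by
      have : ContDiff ℝ (n + 1 : ℕ) f := hf
      push_cast at this
      exact (contDiff_succ_iff_deriv.1 this).2.2
    have hdiff : Differentiable ℝ f := hf.differentiable (by simp)
    have parts := intervalIntegral.integral_mul_deriv_eq_deriv_mul (a := (-1 : ℝ)) (b := 1)
      (u := fun u => (derivative^[n] ((1 - X ^ 2 : ℝ[X]) ^ N)).eval u) (v := f)
      (u' := fun u => (derivative (derivative^[n] ((1 - X ^ 2 : ℝ[X]) ^ N))).eval u)
      (v' := deriv f)
      (fun x _ => Polynomial.hasDerivAt _ x)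
      (fun x _ => (hdiff x).hasDerivAt)
      ((Polynomial.continuous _).intervalIntegrable _ _)
      (hf'.continuous.intervalIntegrable _ _)
    rw [ih (by omega) hf', eval_iterate_derivative_one_sub_sq_pow (by omega) (by norm_num),
      eval_iterate_derivative_one_sub_sq_pow (by omega) (by norm_num)] at parts
    simp only [Function.iterate_succ_apply', iteratedDeriv_succ']
    rw [pow_succ (-1 : ℝ) n]
    linarith

/-- Rescaling of the smoothed third derivative at a point away from the boundary. -/
theorem kappah_eq_integral (k : ℕ) {h t : ℝ} (hh : 0 < h) (ht : t ∈ Ioo h (1 - h))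
    (μ : ℝ → ℝ) :
    kappah k h t μ = (h ^ 3)⁻¹ * ∫ u in (-1 : ℝ)..1, Kd k 3 u * μ (h * u + t) := by
  have hset : Ioc (0 : ℝ) 1 ∩ Icc (t - h) (t + h) = Icc (t - h) (t + h) := by
    obtain ⟨h₁, h₂⟩ := ht
    refine inter_eq_right.2 fun x hx => ⟨?_, ?_⟩
    · linarith [hx.1]
    · linarith [hx.2]
  have hind : (fun x => Kde k 3 ((x - t) / h) * μ x) =
      (Icc (t - h) (t + h)).indicator fun x => Kd k 3 ((x - t) / h) * μ x := by
    funext x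
    have hiff : (x - t) / h ∈ Icc (-1 : ℝ) 1 ↔ x ∈ Icc (t - h) (t + h) := by
      simp only [mem_Icc, le_div_iff₀ hh, div_le_iff₀ hh]
      constructor <;> rintro ⟨h₁, h₂⟩ <;> constructor <;> linarith
    by_cases hx : x ∈ Icc (t - h) (t + h)
    · simp only [Kde, indicator_of_mem hx, if_pos (hiff.2 hx)]
    · simp only [Kde, indicator_of_notMem hx, if_neg (mt hiff.1 hx), zero_mul]
  have hsubst := intervalIntegral.integral_comp_mul_add (a := (-1 : ℝ)) (b := 1)
    (fun x => Kd k 3 ((x - t) / h) * μ x) hh.ne' t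
  have e₁ : h * -1 + t = t - h := by ring
  have e₂ : h * 1 + t = t + h := by ring
  simp only [add_sub_cancel_right, mul_div_cancel_left₀ _ hh.ne', e₁, e₂, smul_eq_mul] at hsubst
  rw [kappah, hind, intervalIntegral.integral_of_le zero_le_one,
    setIntegral_indicator measurableSet_Icc, hset, integral_Icc_eq_integral_Ioc,
    ← intervalIntegral.integral_of_le (by linarith), hsubst]
  field_simp

theorem iteratedDeriv_comp_mul_add {n : ℕ} {f : ℝ → ℝ} (hf : ContDiff ℝ n f) (h t u : ℝ) :
    iteratedDeriv n (fun u => f (h * u + t)) u = h ^ n * iteratedDeriv n f (h * u + t) := by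
  have hg : ContDiff ℝ n fun y => f (y + t) := hf.comp (contDiff_id.add contDiff_const)
  rw [iteratedDeriv_comp_const_mul hg h, iteratedDeriv_comp_add_const]

/-- for a kink-free function, the smoothed third derivative is `O(h^{s-3})`. -/
theorem kappa_no_kink_bound (k : ℕ) (hk : 1 ≤ k) (μ : ℝ → ℝ)
    (hμ : MemG (2*k+1) μ) :
    ∃ C > 0, ∀ h ∈ Set.Ioo (0:ℝ) 1, ∀ t ∈ Set.Ioo h (1-h),
      |kappah k h t μ| ≤ C * h^(2*k-2) := by
  obtain ⟨m, rfl⟩ : ∃ m, k = m + 1 := ⟨k - 1, by omega⟩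
  obtain ⟨c, hc⟩ := kinkPoly_eq_eval_iterate_derivative m
  have hsmooth : ContDiff ℝ (2 * m + 3 : ℕ) μ := by
    have : 2 * (m + 1) + 1 = 2 * m + 3 := by ring
    rw [MemG, this] at hμ
    exact_mod_cast hμ
  obtain ⟨M, hM⟩ := (isCompact_Icc (a := (0 : ℝ)) (b := 1)).exists_bound_of_continuousOn
    (hsmooth.continuous_iteratedDeriv (2 * m + 3) le_rfl).continuousOn
  have hM₀ : 0 ≤ M := (norm_nonneg _).trans (hM 0 (by simp))
  refine ⟨2 * |c| * M + 1, by positivity, fun h ⟨hh, _⟩ t ht => ?_⟩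
  have hKd : Kd (m + 1) 3 = fun x => c *
      (Polynomial.derivative^[2 * m + 3]
        ((1 - Polynomial.X ^ 2 : Polynomial ℝ) ^ (2 * m + 4))).eval x := by
    rw [Kd, hc, Polynomial.iteratedDeriv_eval]
    funext x
    rw [Polynomial.iterate_derivative_C_mul, Polynomial.eval_mul, Polynomial.eval_C,
      ← Function.iterate_add_apply, add_comm 3]
  have hcomp : ContDiff ℝ (2 * m + 3 : ℕ) fun u => μ (h * u + t) :=
    hsmooth.comp ((contDiff_const.mul contDiff_id).add contDiff_const)
  have hκ : kappah (m + 1) h t μ = (h ^ 3)⁻¹ * (c * ((-1) ^ (2 * m + 3) * (h ^ (2 * m + 3) *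
      ∫ u in (-1 : ℝ)..1,
        (1 - u ^ 2) ^ (2 * m + 4) * iteratedDeriv (2 * m + 3) μ (h * u + t)))) := by
    rw [kappah_eq_integral _ hh ht, hKd]
    simp only [mul_assoc c, intervalIntegral.integral_const_mul]
    rw [integral_iterate_derivative_one_sub_sq_pow (by omega) hcomp]
    simp only [iteratedDeriv_comp_mul_add hsmooth, mul_left_comm _ (h ^ (2 * m + 3)),
      intervalIntegral.integral_const_mul]
  have hbound : |∫ u in (-1 : ℝ)..1,
      (1 - u ^ 2) ^ (2 * m + 4) * iteratedDeriv (2 * m + 3) μ (h * u + t)| ≤ M * 2 := by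
    have := intervalIntegral.norm_integral_le_of_norm_le_const (a := (-1 : ℝ)) (b := 1) (C := M)
      (f := fun u => (1 - u ^ 2) ^ (2 * m + 4) * iteratedDeriv (2 * m + 3) μ (h * u + t)) ?_
    · norm_num at this ⊢
      exact this
    · intro u hu
      rw [uIoc_of_le (by norm_num)] at hu
      obtain ⟨hu₁, hu₂⟩ := hu
      have hw : ‖(1 - u ^ 2) ^ (2 * m + 4)‖ ≤ 1 := by
        rw [norm_pow]
        refine pow_le_one₀ (norm_nonneg _) ?_
        rw [Real.norm_eq_abs, abs_le]
        constructor <;> nlinarith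
      have hmem : h * u + t ∈ Icc (0 : ℝ) 1 := by
        constructor <;> nlinarith [ht.1, ht.2]
      rw [norm_mul]
      exact (mul_le_mul hw (hM _ hmem) (norm_nonneg _) zero_le_one).trans_eq (one_mul M)
  rw [hκ, show 2 * (m + 1) - 2 = 2 * m by omega]
  simp only [abs_mul, abs_inv, abs_pow, abs_neg, abs_one, one_pow, one_mul, abs_of_pos hh]
  calc (h ^ 3)⁻¹ * (|c| * (h ^ (2 * m + 3) * _))
      ≤ (h ^ 3)⁻¹ * (|c| * (h ^ (2 * m + 3) * (M * 2))) := by gcongr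
    _ = 2 * |c| * M * h ^ (2 * m) := by
      rw [pow_add]
      field_simp
    _ ≤ (2 * |c| * M + 1) * h ^ (2 * m) := by
      gcongr
      linarith

end
end
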